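/- arXiv:2101.10217 — 2 statements merged into one kernel-verified Lean document; each statement's English description precedes it below -/
import Mathlib

section
/- Let A be a finite-dimensional algebra over a field K with Jacobson radical J, let F be a field extension of K, and assume that the semisimple algebra A/J is separable over K. Then the global dimension of A equals the global dimension of A_F = A ⊗_K F. -/
open CategoryTheory

universe u

section HomologicalDefs

variable (R : Type u) [Ring R]

/-- The `i`-th Ext group of the `R`-modules `M` and `N`, computed in `ModuleCat R`. -/
noncomputable def extGrp (i : ℕ) (M N : ModuleCat.{u} R) : Type u :=
  ((Ext ℤ (ModuleCat.{u} R) i).obj (Opposite.op M)).obj N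

/-- `Ext^i_R(M, N) = 0`. -/
def ExtVanish (i : ℕ) (M N : ModuleCat.{u} R) : Prop :=
  Subsingleton (extGrp R i M N)

/-- `X` lies in `add M`: it is a direct summand of a finite direct sum of copies of `M`. -/
def MemAdd (M X : ModuleCat.{u} R) : Prop :=
  ∃ (k : ℕ) (f : X →ₗ[R] (Fin k → M)) (g : (Fin k → M) →ₗ[R] X),
    g.comp f = LinearMap.id

/-- `M` is an `n`-cluster tilting module for the ring `R`: `M` is a finite module and,
among the finite (= finite-dimensional) `R`-modules `X`, the members of `add M` are exactly
those with `Ext^i(M, X) = 0` for `1 ≤ i ≤ n - 1`, and also exactly those with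
`Ext^i(X, M) = 0` for `1 ≤ i ≤ n - 1`. -/
def IsNClusterTilting (n : ℕ) (M : ModuleCat.{u} R) : Prop :=
  Module.Finite R M ∧
  (∀ X : ModuleCat.{u} R, Module.Finite R X →
    (MemAdd R M X ↔ ∀ i, 1 ≤ i → i ≤ n - 1 → ExtVanish R i M X)) ∧
  (∀ X : ModuleCat.{u} R, Module.Finite R X →
    (MemAdd R M X ↔ ∀ i, 1 ≤ i → i ≤ n - 1 → ExtVanish R i X M))

/-- `X` admits a projective resolution `0 → P_m → ⋯ → P_0 → X → 0` of length at most `m`. -/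
def ProjDimLE (X : ModuleCat.{u} R) (m : ℕ) : Prop :=
  ∃ (P : ℕ → ModuleCat.{u} R) (d : ∀ i, P (i + 1) ⟶ P i) (ε : P 0 ⟶ X),
    (∀ i, i ≤ m → Module.Projective R (P i)) ∧
    (∀ i, m < i → Subsingleton (P i)) ∧
    Function.Surjective ε ∧ Function.Exact (d 0) ε ∧
    (∀ i, Function.Exact (d (i + 1)) (d i))

/-- The projective dimension of the `R`-module `X`, as an extended natural number. -/
noncomputable def projDim (X : ModuleCat.{u} R) : ℕ∞ :=
  sInf {n : ℕ∞ | ∃ m : ℕ, n = (m : ℕ∞) ∧ ProjDimLE R X m}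

/-- The global dimension of the ring `R`: the supremum of the projective dimensions of all
finite (= finite-dimensional) `R`-modules. -/
noncomputable def globalDim : ℕ∞ :=
  ⨆ (X : ModuleCat.{u} R) (_ : Module.Finite R X), projDim R X

/-- There is an exact sequence `0 → R → I_0 → ⋯ → I_{m-1}` of `R`-modules in which every
`I_j` is both projective and injective. -/
def DomDimGE (m : ℕ) : Prop :=
  ∃ (I : ℕ → ModuleCat.{u} R) (f : ModuleCat.of R R ⟶ I 0) (d : ∀ i, I i ⟶ I (i + 1)),
    (∀ i, i < m → Module.Projective R (I i) ∧ Module.Injective R (I i)) ∧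
    (1 ≤ m → Function.Injective f) ∧
    (2 ≤ m → Function.Exact f (d 0)) ∧
    (∀ i, i + 3 ≤ m → Function.Exact (d i) (d (i + 1)))

/-- The dominant dimension of the ring `R`: the supremum of the lengths `m` of exact sequences
`0 → R → I_0 → ⋯ → I_{m-1}` with all `I_j` projective and injective. -/
noncomputable def domDim : ℕ∞ :=
  sSup {n : ℕ∞ | ∃ m : ℕ, n = (m : ℕ∞) ∧ DomDimGE R m}

end HomologicalDefs

/-- If `A` is a `K`-algebra and `c` is a ring congruence on `A`, the quotient ring `A ⧸ c`
is again a `K`-algebra (via the composite of the quotient map with `algebraMap K A`). -/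
noncomputable instance ringConQuotientAlgebra (K : Type u) [CommSemiring K] (A : Type u)
    [Ring A] [Algebra K A] (c : RingCon A) : Algebra K c.Quotient :=
  RingHom.toAlgebra' ((RingCon.mk' c).comp (algebraMap K A)) (by
    intro k x
    induction x using Quotient.inductionOn' with
    | h a =>
      show (↑(algebraMap K A k) : c.Quotient) * ↑a = ↑a * ↑(algebraMap K A k)
      rw [← RingCon.coe_mul, ← RingCon.coe_mul, Algebra.commutes])


section ProjectiveDimension

variable {R : Type u} [Ring R]

lemma hasProjectiveDimensionLE_succ_iff_ker {P X : Type u} [AddCommGroup P] [Module R P]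
    [AddCommGroup X] [Module R X] [Module.Projective R P] (f : P →ₗ[R] X)
    (hf : Function.Surjective f) (n : ℕ) :
    HasProjectiveDimensionLE (ModuleCat.of R X) (n + 1) ↔
      HasProjectiveDimensionLE (ModuleCat.of R (LinearMap.ker f)) n :=
  (LinearMap.shortExact_shortComplexKer hf).hasProjectiveDimensionLT_X₃_iff n
    ((IsProjective.iff_projective P).mp inferInstance)

lemma hasProjectiveDimensionLE_zero_iff (X : ModuleCat.{u} R) :
    HasProjectiveDimensionLE X 0 ↔ Module.Projective R X := by
  rw [← projective_iff_hasProjectiveDimensionLE_zero]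
  exact (IsProjective.iff_projective X).symm

lemma ProjDimLE.hasProjectiveDimensionLE {m : ℕ} {X : ModuleCat.{u} R} (h : ProjDimLE R X m) :
    HasProjectiveDimensionLE X m := by
  induction m generalizing X with
  | zero =>
    obtain ⟨P, d, ε, hP, hP', hε, hd, -⟩ := h
    have := hP 0 le_rfl
    have := hP' 1 one_pos
    rw [hasProjectiveDimensionLE_zero_iff]
    refine Module.Projective.of_equiv (LinearEquiv.ofBijective ε.hom ⟨?_, hε⟩)
    refine (injective_iff_map_eq_zero _).mpr fun x hx ↦ ?_
    obtain ⟨y, rfl⟩ := (hd x).mp hx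
    rw [Subsingleton.elim y 0, map_zero]
  | succ m ih =>
    obtain ⟨P, d, ε, hP, hP', hε, hd, hd'⟩ := h
    have := hP 0 (Nat.zero_le _)
    refine (hasProjectiveDimensionLE_succ_iff_ker ε.hom hε m).mpr (ih ?_)
    refine ⟨fun i ↦ P (i + 1), fun i ↦ d (i + 1),
      ModuleCat.ofHom ((d 0).hom.codRestrict _ fun x ↦ (hd _).mpr ⟨x, rfl⟩),
      fun i hi ↦ hP _ (by lia), fun i hi ↦ hP' _ (by lia), ?_, ?_, fun i ↦ hd' (i + 1)⟩
    · rintro ⟨y, hy⟩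
      obtain ⟨x, rfl⟩ := (hd y).mp hy
      exact ⟨x, rfl⟩
    · intro x
      rw [← hd' 0 x]
      exact Subtype.ext_iff

lemma projDimLE_of_hasProjectiveDimensionLE {m : ℕ} {X : ModuleCat.{u} R}
    (h : HasProjectiveDimensionLE X m) : ProjDimLE R X m := by
  induction m generalizing X with
  | zero =>
    rw [hasProjectiveDimensionLE_zero_iff] at h
    refine ⟨fun i ↦ Nat.casesOn i X fun _ ↦ ModuleCat.of R PUnit, fun i ↦ 0, 𝟙 X, ?_, ?_,
      Function.surjective_id, ?_, ?_⟩
    · rintro i hi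
      obtain rfl : i = 0 := by lia
      exact h
    · rintro (_ | i) hi
      · lia
      · exact inferInstanceAs (Subsingleton PUnit)
    · exact fun x ↦ ⟨fun hx ↦ ⟨0, hx.symm⟩, by rintro ⟨y, rfl⟩; rfl⟩
    · exact fun i x ↦ ⟨fun _ ↦ ⟨0, Subsingleton.elim (α := PUnit) _ _⟩, fun _ ↦ rfl⟩
  | succ m ih =>
    let f : (X →₀ R) →ₗ[R] X := Finsupp.linearCombination R id
    have hf : Function.Surjective f := Finsupp.linearCombination_surjective _ Function.surjective_id
    obtain ⟨P, d, ε, hP, hP', hε, hd, hd'⟩ :=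
      ih ((hasProjectiveDimensionLE_succ_iff_ker f hf m).mp h)
    let Q : ℕ → ModuleCat.{u} R := fun i ↦ Nat.casesOn i (ModuleCat.of R (X →₀ R)) P
    let δ : ∀ i, Q (i + 1) ⟶ Q i := fun i ↦
      Nat.casesOn i (ε ≫ ModuleCat.ofHom (LinearMap.ker f).subtype) d
    refine ⟨Q, δ, ModuleCat.ofHom f, ?_, ?_, hf, ?_, ?_⟩
    · rintro (_ | i) hi
      · exact inferInstanceAs (Module.Projective R (X →₀ R))
      · exact hP i (by lia)
    · rintro (_ | i) hi
      · lia
      · exact hP' i (by lia)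
    · intro x
      constructor
      · intro hx
        obtain ⟨y, hy⟩ := hε ⟨x, hx⟩
        exact ⟨y, congrArg Subtype.val hy⟩
      · rintro ⟨y, rfl⟩
        exact (ε y).2
    · rintro (_ | i)
      · intro x
        exact (Subtype.ext_iff (a1 := ε x) (a2 := 0)).symm.trans (hd x)
      · exact hd' i

lemma projDim_le_iff (X : ModuleCat.{u} R) (n : ℕ) :
    projDim R X ≤ n ↔ HasProjectiveDimensionLE X n := by
  constructor
  · intro h
    have hne : {n : ℕ∞ | ∃ m : ℕ, n = (m : ℕ∞) ∧ ProjDimLE R X m}.Nonempty := by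
      by_contra hne
      rw [projDim, Set.not_nonempty_iff_eq_empty.mp hne, sInf_empty] at h
      exact absurd h (by simp)
    obtain ⟨m, hm, hX⟩ := csInf_mem hne
    have hmn : m ≤ n := by
      rw [projDim, hm] at h
      exact_mod_cast h
    have := hX.hasProjectiveDimensionLE
    exact hasProjectiveDimensionLT_of_ge X (m + 1) (n + 1) (by lia)
  · exact fun h ↦ sInf_le ⟨n, rfl, projDimLE_of_hasProjectiveDimensionLE h⟩

lemma globalDim_le_iff (n : ℕ) :
    globalDim R ≤ n ↔
      ∀ X : ModuleCat.{u} R, Module.Finite R X → HasProjectiveDimensionLE X n := by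
  simp only [globalDim, iSup_le_iff, projDim_le_iff]

lemma globalDim_le_globalDim {S : Type u} [Ring S]
    (h : ∀ n : ℕ, (∀ X : ModuleCat.{u} S, Module.Finite S X → HasProjectiveDimensionLE X n) →
      ∀ X : ModuleCat.{u} R, Module.Finite R X → HasProjectiveDimensionLE X n) :
    globalDim R ≤ globalDim S := by
  generalize hS : globalDim S = b
  cases b with
  | top => exact le_top
  | coe n => exact (globalDim_le_iff n).mpr (h n ((globalDim_le_iff n).mp hS.le))

attribute [local instance] RingHomInvPair.of_ringEquiv in
lemma globalDim_le_of_ringEquiv {S : Type u} [Ring S] (e : R ≃+* S) :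
    globalDim R ≤ globalDim S := by
  refine globalDim_le_globalDim fun n h X hX ↦ ?_
  let : Module S X := Module.compHom X e.symm.toRingHom
  let e' : ModuleCat.of S X ≃ₛₗ[RingHomClass.toRingHom e.symm] X :=
    { AddEquiv.refl X with map_smul' := fun _ _ ↦ rfl }
  have : Module.Finite S (ModuleCat.of S X) :=
    .of_surjective e'.symm.toLinearMap e'.symm.surjective
  have := h (ModuleCat.of S X) this
  exact ModuleCat.hasProjectiveDimensionLE_of_semiLinearEquiv e.symm e' n

lemma globalDim_eq_of_ringEquiv {S : Type u} [Ring S] (e : R ≃+* S) :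
    globalDim R = globalDim S :=
  (globalDim_le_of_ringEquiv e).antisymm (globalDim_le_of_ringEquiv e.symm)

lemma HasProjectiveDimensionLE.of_retract {M N : Type u} [AddCommGroup M] [Module R M]
    [AddCommGroup N] [Module R N] (i : M →ₗ[R] N) (r : N →ₗ[R] M) (h : r ∘ₗ i = LinearMap.id)
    {n : ℕ} (hN : HasProjectiveDimensionLE (ModuleCat.of R N) n) :
    HasProjectiveDimensionLE (ModuleCat.of R M) n :=
  Retract.hasProjectiveDimensionLT (Y := ModuleCat.of R N)
    { i := ModuleCat.ofHom i, r := ModuleCat.ofHom r, retract := ModuleCat.hom_ext h } (n + 1)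

lemma IsFiniteLength.hasProjectiveDimensionLE {n : ℕ}
    (h : ∀ (T : Type u) [AddCommGroup T] [Module R T], IsSimpleModule R T →
      HasProjectiveDimensionLE (ModuleCat.of R T) n)
    {M : Type u} [AddCommGroup M] [Module R M] (hM : IsFiniteLength R M) :
    HasProjectiveDimensionLE (ModuleCat.of R M) n := by
  induction hM with
  | @of_subsingleton M _ _ _ =>
    have := (ModuleCat.isZero_of_subsingleton (ModuleCat.of R M)).hasProjectiveDimensionLT_zero
    exact hasProjectiveDimensionLT_of_ge _ 0 (n + 1) (by lia)
  | @of_simple_quotient M _ _ N _ _ ih =>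
    have hN : HasProjectiveDimensionLE (ModuleCat.of R (LinearMap.ker N.mkQ)) n := by
      rwa [N.ker_mkQ]
    exact (LinearMap.shortExact_shortComplexKer N.mkQ_surjective).hasProjectiveDimensionLT_X₂
      (n + 1) hN (h _ inferInstance)

lemma Module.Projective.restrictScalars_compHom {S : Type u} [Ring S] (φ : R →+* S)
    (hφ : letI := Module.compHom S φ; Module.Projective R S) (P : Type u) [AddCommGroup P]
    [Module S P] [Module.Projective S P] :
    letI := Module.compHom P φ; Module.Projective R P := by
  obtain ⟨s, hs⟩ := Module.projective_def'.mp ‹Module.Projective S P›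
  let := Module.compHom S φ
  let := Module.compHom P φ
  have hF (r : R) (m : P →₀ S) : r • m = φ r • m := by ext; rfl
  let i : P →ₗ[R] P →₀ S :=
    { s with map_smul' := fun r x ↦ (s.map_smul (φ r) x).trans (hF r (s x)).symm }
  let p : (P →₀ S) →ₗ[R] P :=
    { Finsupp.linearCombination S id with
      map_smul' := fun r x ↦ (congrArg _ (hF r x)).trans
        ((Finsupp.linearCombination S id).map_smul (φ r) x) }
  have : Module.Projective R (P →₀ S) := by
    classical
    exact .of_equiv' (finsuppLequivDFinsupp R).symm
  exact Module.Projective.of_split i p (LinearMap.ext fun x ↦ congrArg (fun f ↦ f x) hs)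

lemma ProjDimLE.restrictScalars {S : Type u} [Ring S] (φ : R →+* S)
    (hφ : letI := Module.compHom S φ; Module.Projective R S) {X : ModuleCat.{u} S} {m : ℕ}
    (h : ProjDimLE S X m) : ProjDimLE R ((ModuleCat.restrictScalars φ).obj X) m := by
  obtain ⟨P, d, ε, hP, hP', hε, hd, hd'⟩ := h
  refine ⟨fun i ↦ (ModuleCat.restrictScalars φ).obj (P i),
    fun i ↦ (ModuleCat.restrictScalars φ).map (d i), (ModuleCat.restrictScalars φ).map ε,
    fun i hi ↦ ?_, hP', hε, hd, hd'⟩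
  have := hP i hi
  exact Module.Projective.restrictScalars_compHom φ hφ (P i)

end ProjectiveDimension

section ScalarExtension

open TensorProduct

variable (K : Type u) [Field K] (F : Type u) [Field F] [Algebra K F]

/-- The scalar extension `F ⊗[K] M`. For a module `M` over a `K`-algebra `R`, it carries the
natural structure of a module over `F ⊗[K] R`. -/
def ScalarExtension (M : Type u) [AddCommGroup M] [Module K M] : Type u := F ⊗[K] M

namespace ScalarExtension

variable {R : Type u} [Ring R] [Algebra K R]
variable {M : Type u} [AddCommGroup M] [Module K M] [Module R M] [IsScalarTower K R M]
variable {N : Type u} [AddCommGroup N] [Module K N] [Module R N] [IsScalarTower K R N]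

noncomputable instance : AddCommGroup (ScalarExtension K F M) :=
  inferInstanceAs (AddCommGroup (F ⊗[K] M))

variable (R M) in
/-- The action of `F ⊗[K] R` on `F ⊗[K] M`. -/
noncomputable def toEnd : F ⊗[K] R →ₐ[F] Module.End F (F ⊗[K] M) :=
  Algebra.TensorProduct.lift (Algebra.ofId F _)
    ((Module.End.baseChangeHom K F M).comp (Algebra.lsmul K K M))
    fun a _ ↦ Algebra.commutes a _

noncomputable instance : Module (F ⊗[K] R) (ScalarExtension K F M) :=
  Module.compHom (F ⊗[K] M) (toEnd K F R M).toRingHom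

/-- Pure tensors in the scalar extension. -/
noncomputable def tmul (a : F) (m : M) : ScalarExtension K F M := a ⊗ₜ[K] m

omit [Module R M] [IsScalarTower K R M] in
lemma tmul_add (a : F) (m n : M) : tmul K F a (m + n) = tmul K F a m + tmul K F a n :=
  TensorProduct.tmul_add a m n

omit [Module R M] [IsScalarTower K R M] in
lemma tmul_zero (a : F) : tmul K F a (0 : M) = 0 :=
  TensorProduct.tmul_zero M a

lemma smul_tmul (a b : F) (r : R) (m : M) :
    (a ⊗ₜ[K] r) • tmul K F b m = tmul K F (a * b) (r • m) := by
  change toEnd K F R M (a ⊗ₜ r) (b ⊗ₜ m) = _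
  refine (LinearMap.congr_fun (Algebra.TensorProduct.lift_tmul _ _ _ a r) _).trans ?_
  rfl

omit [Module R M] [IsScalarTower K R M] in
variable {K F} in
@[elab_as_elim]
lemma induction_on {p : ScalarExtension K F M → Prop} (x : ScalarExtension K F M)
    (zero : p 0) (tmul : ∀ a m, p (tmul K F a m)) (add : ∀ x y, p x → p y → p (x + y)) : p x :=
  TensorProduct.induction_on x zero tmul add

variable {P : Type u} [AddCommGroup P] [Module (F ⊗[K] R) P]

/-- A map from an `R`-module to an `F ⊗[K] R`-module that is compatible with the action of `R`
extends to the scalar extension. -/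
noncomputable def lift (g : M →+ P) (hg : ∀ (r : R) m, g (r • m) = (1 ⊗ₜ[K] r : F ⊗[K] R) • g m) :
    ScalarExtension K F M →ₗ[F ⊗[K] R] P :=
  have key (a : F) (m : M) (k : K) : (algebraMap K F k * a) ⊗ₜ[K] (1 : R) • g m =
      a ⊗ₜ[K] (1 : R) • g (k • m) := by
    rw [← algebraMap_smul R k m, hg, smul_smul, Algebra.TensorProduct.tmul_mul_tmul, mul_one,
      one_mul, ← Algebra.smul_def, TensorProduct.smul_tmul, Algebra.smul_def, mul_one]
  let φ : F →+ M →+ P :=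
    { toFun a := (DistribSMul.toAddMonoidHom P (a ⊗ₜ[K] (1 : R) : F ⊗[K] R)).comp g
      map_zero' := by ext; simp
      map_add' _ _ := by ext; simp [TensorProduct.add_tmul, add_smul] }
  let L : ScalarExtension K F M →+ P :=
    TensorProduct.liftAddHom φ fun k a m ↦ by
      rw [Algebra.smul_def]
      exact key a m k
  { L with
    map_smul' := fun s x ↦ by
      change L (s • x) = s • L x
      have hL (a : F) (m : M) : L (tmul K F a m) = a ⊗ₜ[K] (1 : R) • g m := rfl
      induction x using induction_on with
      | zero => simp
      | add x y hx hy => rw [smul_add, map_add, hx, hy, map_add, smul_add]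
      | tmul b m =>
        induction s with
        | zero => simp
        | add s t hs ht => rw [add_smul, map_add, hs, ht, ← add_smul]
        | tmul a r =>
          rw [smul_tmul, hL, hL, hg, smul_smul, smul_smul]
          simp }

lemma lift_tmul (g : M →+ P) (hg : ∀ (r : R) m, g (r • m) = (1 ⊗ₜ[K] r : F ⊗[K] R) • g m)
    (a : F) (m : M) : lift K F g hg (tmul K F a m) = a ⊗ₜ[K] (1 : R) • g m := rfl

/-- The scalar extension of an `R`-linear map. -/
noncomputable def map (f : M →ₗ[R] N) :
    ScalarExtension K F M →ₗ[F ⊗[K] R] ScalarExtension K F N :=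
  lift K F
    { toFun := fun m ↦ tmul K F 1 (f m)
      map_zero' := by rw [map_zero, tmul_zero]
      map_add' := fun m n ↦ by rw [map_add, tmul_add] }
    (fun r m ↦ by simp [smul_tmul])

lemma coe_map (f : M →ₗ[R] N) : ⇑(map K F f) = (f.restrictScalars K).lTensor F := by
  ext x
  induction x using induction_on with
  | zero => exact (map_zero (map K F f)).trans (map_zero ((f.restrictScalars K).lTensor F)).symm
  | add x y hx hy =>
    exact (map_add (map K F f) x y).trans
      ((congrArg₂ _ hx hy).trans (map_add ((f.restrictScalars K).lTensor F) x y).symm)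
  | tmul a m =>
    rw [map, lift_tmul]
    simp only [AddMonoidHom.coe_mk, ZeroHom.coe_mk, smul_tmul, mul_one, one_smul]
    rfl

lemma linearMap_ext {f g : ScalarExtension K F M →ₗ[F ⊗[K] R] P}
    (h : ∀ m, f (tmul K F 1 m) = g (tmul K F 1 m)) : f = g := by
  ext x
  induction x using induction_on with
  | zero => simp
  | add x y hx hy => rw [map_add, map_add, hx, hy]
  | tmul a m =>
    have : tmul K F a m = (a ⊗ₜ[K] (1 : R)) • tmul K F 1 m := by simp [smul_tmul]
    rw [this, map_smul, map_smul, h]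

instance [Module.Projective R M] : Module.Projective (F ⊗[K] R) (ScalarExtension K F M) := by
  refine .of_lifting_property'' fun f hf ↦ ?_
  let ι : R →+* F ⊗[K] R := (Algebra.TensorProduct.includeRight : R →ₐ[K] F ⊗[K] R).toRingHom
  let : Module R (ScalarExtension K F M) := Module.compHom _ ι
  let : Module R (ScalarExtension K F M →₀ F ⊗[K] R) := Module.compHom _ ι
  let f' : (ScalarExtension K F M →₀ F ⊗[K] R) →ₗ[R] ScalarExtension K F M :=
    { f with map_smul' := fun r x ↦ f.map_smul (ι r) x }
  let j : M →ₗ[R] ScalarExtension K F M :=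
    { toFun := tmul K F 1
      map_add' := tmul_add K F 1
      map_smul' := fun r m ↦ ((smul_tmul K F 1 1 r m).trans (by rw [mul_one])).symm }
  obtain ⟨h, hh⟩ := Module.projective_lifting_property f' j hf
  have hsmul (r : R) (m : M) : h.toAddMonoidHom (r • m) =
      (1 ⊗ₜ[K] r : F ⊗[K] R) • h.toAddMonoidHom m := h.map_smul r m
  refine ⟨lift K F h.toAddMonoidHom hsmul, linearMap_ext K F fun m ↦ ?_⟩
  rw [LinearMap.comp_apply, lift_tmul, ← Algebra.TensorProduct.one_def, one_smul]
  exact LinearMap.congr_fun hh m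

instance [Module.Finite R M] : Module.Finite (F ⊗[K] R) (ScalarExtension K F M) := by
  obtain ⟨s, hs⟩ := Module.Finite.fg_top (R := R) (M := M)
  classical
  refine ⟨s.image (tmul K F 1), eq_top_iff.mpr fun x _ ↦ ?_⟩
  set T := Submodule.span (F ⊗[K] R) (s.image (tmul K F 1) : Set (ScalarExtension K F M))
  have h1 (m : M) : tmul K F 1 m ∈ T := by
    have hm : m ∈ Submodule.span R (s : Set M) := hs ▸ Submodule.mem_top
    induction hm using Submodule.span_induction with
    | mem m hm => exact Submodule.subset_span (Finset.mem_coe.mpr (Finset.mem_image_of_mem _ hm))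
    | zero => exact by rw [tmul_zero]; exact T.zero_mem
    | add x y _ _ hx hy => exact tmul_add K F 1 x y ▸ T.add_mem hx hy
    | smul r x _ hx =>
      have := T.smul_mem ((1 : F) ⊗ₜ[K] r) hx
      rwa [smul_tmul, mul_one] at this
  induction x using induction_on with
  | zero => exact T.zero_mem
  | add x y hx hy => exact T.add_mem (hx trivial) (hy trivial)
  | tmul a m =>
    have := T.smul_mem (a ⊗ₜ[K] (1 : R)) (h1 m)
    rwa [smul_tmul, mul_one, one_smul] at this

end ScalarExtension

open ModuleCat.Algebra in
lemma ProjDimLE.scalarExtension {R : Type u} [Ring R] [Algebra K R] {X : ModuleCat.{u} R} {m : ℕ}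
    (h : ProjDimLE R X m) :
    ProjDimLE (F ⊗[K] R) (ModuleCat.of (F ⊗[K] R) (ScalarExtension K F X)) m := by
  obtain ⟨P, d, ε, hP, hP', hε, hd, hd'⟩ := h
  refine ⟨fun i ↦ ModuleCat.of _ (ScalarExtension K F (P i)),
    fun i ↦ ModuleCat.ofHom (ScalarExtension.map K F (d i).hom),
    ModuleCat.ofHom (ScalarExtension.map K F ε.hom), fun i hi ↦ ?_, fun i hi ↦ ?_, ?_, ?_,
    fun i ↦ ?_⟩
  · have := hP i hi
    exact inferInstanceAs (Module.Projective (F ⊗[K] R) (ScalarExtension K F (P i)))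
  · have := hP' i hi
    exact inferInstanceAs (Subsingleton (F ⊗[K] P i))
  · change Function.Surjective (ScalarExtension.map K F ε.hom)
    rw [ScalarExtension.coe_map]
    exact LinearMap.lTensor_surjective F hε
  · change Function.Exact (ScalarExtension.map K F (d 0).hom) (ScalarExtension.map K F ε.hom)
    rw [ScalarExtension.coe_map, ScalarExtension.coe_map]
    exact Module.Flat.lTensor_exact F hd
  · change Function.Exact (ScalarExtension.map K F (d (i + 1)).hom)
      (ScalarExtension.map K F (d i).hom)
    rw [ScalarExtension.coe_map, ScalarExtension.coe_map]
    exact Module.Flat.lTensor_exact F (hd' i)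

end ScalarExtension

section GlobalDimension

open TensorProduct

variable (K : Type u) [Field K] (F : Type u) [Field F] [Algebra K F]

lemma Module.Projective.includeRight_compHom (R : Type u) [Ring R] [Algebra K R] :
    letI := Module.compHom (F ⊗[K] R)
      (Algebra.TensorProduct.includeRight : R →ₐ[K] F ⊗[K] R).toRingHom
    Module.Projective R (F ⊗[K] R) := by
  let ι : R →+* F ⊗[K] R := (Algebra.TensorProduct.includeRight : R →ₐ[K] F ⊗[K] R).toRingHom
  let := Module.compHom (F ⊗[K] R) ι
  have : Module.Projective R (R ⊗[K] F) :=
    .of_basis (Algebra.TensorProduct.basis R (Module.Free.chooseBasis K F))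
  let e : R ⊗[K] F ≃ₗ[R] F ⊗[K] R :=
    { TensorProduct.comm K R F with
      map_smul' := fun r x ↦ by
        change TensorProduct.comm K R F (r • x) = (1 ⊗ₜ[K] r) * TensorProduct.comm K R F x
        induction x with
        | zero => simp
        | add x y hx hy => rw [smul_add, map_add, hx, hy, map_add, mul_add]
        | tmul s a => simp [TensorProduct.smul_tmul'] }
  exact .of_equiv' e

lemma ScalarExtension.exists_retraction {R : Type u} [Ring R] [Algebra K R] (M : Type u)
    [AddCommGroup M] [Module K M] [Module R M] [IsScalarTower K R M] :
    ∃ ρ : ScalarExtension K F M →+ M, (∀ m, ρ (tmul K F 1 m) = m) ∧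
      ∀ (r : R) x, ρ (((1 : F) ⊗ₜ[K] r) • x) = r • ρ x := by
  obtain ⟨φ, hφ⟩ := (Algebra.linearMap K F).exists_leftInverse_of_injective
    (LinearMap.ker_eq_bot.mpr (algebraMap K F).injective)
  have hφ1 : φ 1 = 1 := by simpa using LinearMap.congr_fun hφ 1
  let ρ : ScalarExtension K F M →+ M :=
    (TensorProduct.lid K M ∘ₗ φ.rTensor M : F ⊗[K] M →ₗ[K] M).toAddMonoidHom
  have hρ (a : F) (m : M) : ρ (tmul K F a m) = φ a • m := rfl
  refine ⟨ρ, fun m ↦ by rw [hρ, hφ1, one_smul], fun r x ↦ ?_⟩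
  induction x using induction_on with
  | zero => simp
  | add x y hx hy => rw [smul_add, map_add, hx, hy, map_add, smul_add]
  | tmul a m =>
    rw [smul_tmul, one_mul, hρ, hρ, ← algebraMap_smul R (φ a), ← algebraMap_smul R (φ a) m,
      smul_smul, smul_smul, Algebra.commutes]

open ModuleCat.Algebra in
theorem globalDim_le_globalDim_tensorProduct (R : Type u) [Ring R] [Algebra K R] :
    globalDim R ≤ globalDim (F ⊗[K] R) := by
  refine globalDim_le_globalDim fun n h X hX ↦ ?_
  let ι : R →+* F ⊗[K] R := (Algebra.TensorProduct.includeRight : R →ₐ[K] F ⊗[K] R).toRingHom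
  let E : ModuleCat.{u} (F ⊗[K] R) := ModuleCat.of (F ⊗[K] R) (ScalarExtension K F X)
  have hE : ProjDimLE _ E n := projDimLE_of_hasProjectiveDimensionLE
    (h E (inferInstanceAs (Module.Finite (F ⊗[K] R) (ScalarExtension K F X))))
  have hE' := (hE.restrictScalars ι
    (Module.Projective.includeRight_compHom K F R)).hasProjectiveDimensionLE
  obtain ⟨ρ, hρ, hρ'⟩ := ScalarExtension.exists_retraction K F (R := R) X
  let i : X →ₗ[R] (ModuleCat.restrictScalars ι).obj E :=
    { toFun := fun x ↦ ScalarExtension.tmul K F 1 x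
      map_add' := ScalarExtension.tmul_add K F 1
      map_smul' := fun r x ↦
        ((ScalarExtension.smul_tmul K F 1 1 r x).trans (by rw [mul_one])).symm }
  let p : (ModuleCat.restrictScalars ι).obj E →ₗ[R] X :=
    { toFun := ρ
      map_add' := ρ.map_add
      map_smul' := hρ' }
  exact HasProjectiveDimensionLE.of_retract i p (LinearMap.ext hρ) hE'

variable {K} {R B : Type u} [Ring R] [Algebra K R] [Ring B] [Algebra K B]

lemma exists_ne_zero_forall_smul_eq_zero {R S T : Type*} [Ring R] [Ring S]
    (ι : R →+* S) [AddCommGroup T] [Module S T] [Nontrivial T] (J : Set R) {k : ℕ}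
    (hJ : ∀ l : List R, l.length = k → (∀ x ∈ l, x ∈ J) → l.prod = 0) :
    ∃ t : T, t ≠ 0 ∧ ∀ x ∈ J, ι x • t = 0 := by
  by_contra! H
  obtain ⟨t₀, ht₀⟩ := exists_ne (0 : T)
  have key : ∀ m : ℕ, ∃ l : List R, l.length = m ∧ (∀ x ∈ l, x ∈ J) ∧ ι l.prod • t₀ ≠ 0 := by
    intro m
    induction m with
    | zero => exact ⟨[], rfl, by simp, by simpa⟩
    | succ m ih =>
      obtain ⟨l, hl, hlJ, hlt⟩ := ih
      obtain ⟨x, hx, hxt⟩ := H _ hlt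
      exact ⟨x :: l, by simp [hl], by simpa [hx] using hlJ, by simpa [mul_smul] using hxt⟩
  obtain ⟨l, hl, hlJ, hlt⟩ := key k
  simp [hJ l hl hlJ] at hlt

lemma ScalarExtension.isSemisimpleModule (π : R →ₐ[K] B) (hπ : Function.Surjective π)
    [IsSemisimpleRing (F ⊗[K] B)] {M : Type u} [AddCommGroup M] [Module K M] [Module R M]
    [IsScalarTower K R M] (f : M →ₗ[K] B) (hf : Function.Bijective f)
    (hfπ : ∀ (r : R) m, f (r • m) = π r * f m) :
    IsSemisimpleModule (F ⊗[K] R) (ScalarExtension K F M) := by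
  let σ : F ⊗[K] R →+* F ⊗[K] B := (Algebra.TensorProduct.map (AlgHom.id F F) π).toRingHom
  have hσ : Function.Surjective σ := LinearMap.lTensor_surjective (g := π.toLinearMap) F hπ
  have : RingHomSurjective σ := ⟨hσ⟩
  let g : ScalarExtension K F M →+ F ⊗[K] B := (f.lTensor F).toAddMonoidHom
  have hg (a : F) (m : M) : g (tmul K F a m) = a ⊗ₜ f m := rfl
  let e : ScalarExtension K F M →ₛₗ[σ] F ⊗[K] B :=
    { g with
      map_smul' := fun s x ↦ by
        change g (s • x) = σ s * g x
        induction x using induction_on with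
        | zero => simp
        | add x y hx hy => rw [smul_add, map_add, hx, hy, map_add, mul_add]
        | tmul b m =>
          induction s with
          | zero => simp
          | add s t hs ht => rw [add_smul, map_add, hs, ht, map_add, add_mul]
          | tmul a r =>
            rw [smul_tmul, hg, hg, hfπ]
            exact (Algebra.TensorProduct.tmul_mul_tmul a b (π r) (f m)).symm }
  have he : Function.Bijective e := (TensorProduct.congr (.refl K F) (.ofBijective f hf)).bijective
  exact (e.isSemisimpleModule_iff_of_bijective he).mpr inferInstance

open ModuleCat.Algebra in
theorem globalDim_tensorProduct_le_globalDim [FiniteDimensional K R] (π : R →ₐ[K] B)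
    (hπ : Function.Surjective π) [IsSemisimpleRing (F ⊗[K] B)] {k : ℕ}
    (hk : ∀ l : List R, l.length = k → (∀ x ∈ l, π x = 0) → l.prod = 0) :
    globalDim (F ⊗[K] R) ≤ globalDim R := by
  refine globalDim_le_globalDim fun n h X hX ↦ ?_
  have : IsArtinianRing (F ⊗[K] R) := isArtinian_of_tower F inferInstance
  have hfin : IsFiniteLength (F ⊗[K] R) X :=
    isFiniteLength_iff_isNoetherian_isArtinian.mpr ⟨inferInstance, inferInstance⟩
  refine IsFiniteLength.hasProjectiveDimensionLE (fun T _ _ _ ↦ ?_) hfin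
  have := IsSimpleModule.nontrivial (F ⊗[K] R) T
  let ι : R →+* F ⊗[K] R := (Algebra.TensorProduct.includeRight : R →ₐ[K] F ⊗[K] R).toRingHom
  obtain ⟨t, ht, htπ⟩ := exists_ne_zero_forall_smul_eq_zero (T := T) ι
    {x | π x = 0} hk
  obtain ⟨M, ψ, hψ⟩ : ∃ (M : ModuleCat.{u} R) (ψ : M ≃+ B), ∀ r m, ψ (r • m) = π r * ψ m :=
    let : Module R B := Module.compHom B π.toRingHom
    ⟨ModuleCat.of R B, .refl B, fun _ _ ↦ rfl⟩
  let πl : R →ₗ[R] M :=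
    { (ψ.symm : B →+ M).comp (π : R →+ B) with
      map_smul' := fun r s ↦ ψ.symm_apply_eq.mpr <| by simp [hψ] }
  have hπl : Function.Surjective πl := ψ.symm.surjective.comp hπ
  have hM : Module.Finite R M := .of_surjective πl hπl
  have hE := ((projDimLE_of_hasProjectiveDimensionLE (h M hM)).scalarExtension
    K F).hasProjectiveDimensionLE
  let f : M →ₗ[K] B :=
    { ψ with
      map_smul' := fun c b ↦ by
        change ψ (algebraMap K R c • b) = c • ψ b
        rw [hψ, AlgHom.commutes, Algebra.smul_def] }
  have : IsSemisimpleModule (F ⊗[K] R) (ScalarExtension K F M) :=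
    ScalarExtension.isSemisimpleModule F π hπ f ψ.bijective hψ
  let : Module R T := Module.compHom T ι
  have hker : LinearMap.ker πl ≤ LinearMap.ker (LinearMap.toSpanSingleton R T t) := fun x hx ↦
    htπ x (by simpa [πl] using hx)
  let g : M →ₗ[R] T := (LinearMap.ker πl).liftQ _ hker ∘ₗ
    (πl.quotKerEquivOfSurjective hπl).symm.toLinearMap
  have hg : g (πl 1) = t := by
    have : (πl.quotKerEquivOfSurjective hπl).symm (πl 1) = Submodule.Quotient.mk 1 := by
      rw [LinearEquiv.symm_apply_eq]
      rfl
    change (LinearMap.ker πl).liftQ _ hker ((πl.quotKerEquivOfSurjective hπl).symm (πl 1)) = t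
    rw [this]
    exact one_smul R t
  let q : ScalarExtension K F M →ₗ[F ⊗[K] R] T :=
    ScalarExtension.lift K F g.toAddMonoidHom fun r m ↦ g.map_smul r m
  have hq : q ≠ 0 := fun hq0 ↦ ht <| by
    have : q (ScalarExtension.tmul K F 1 (πl 1)) = t := by
      refine (ScalarExtension.lift_tmul K F _ _ 1 _).trans ?_
      rw [← Algebra.TensorProduct.one_def, one_smul]
      exact hg
    rw [← this, hq0, LinearMap.zero_apply]
  obtain ⟨j, hj⟩ := IsSemisimpleModule.lifting_property q (LinearMap.surjective_of_ne_zero hq)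
    LinearMap.id
  exact HasProjectiveDimensionLE.of_retract j q hj hE

end GlobalDimension

section JacobsonRadical

open TensorProduct

variable {A : Type u} [Ring A]

lemma Ideal.list_prod_mem_pow (I : Ideal A) (l : List A) (hl : ∀ x ∈ l, x ∈ I) :
    l.prod ∈ I ^ l.length := by
  induction l using List.reverseRecOn with
  | nil => exact Submodule.one_le.mp (Submodule.pow_zero (M := I)).ge
  | append_singleton l x ih =>
    rw [List.prod_append, List.prod_singleton, List.length_append, List.length_singleton,
      Submodule.pow_succ]
    exact Ideal.mul_mem_mul (ih fun y hy ↦ hl y (by simp [hy])) (hl x (by simp))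

lemma TwoSidedIdeal.exists_list_prod_eq_zero_of_jacobson [IsArtinianRing A] :
    ∃ k : ℕ, ∀ l : List A, l.length = k → (∀ x ∈ l, x ∈ (⊥ : TwoSidedIdeal A).jacobson) →
      l.prod = 0 := by
  obtain ⟨k, hk⟩ := IsSemiprimaryRing.isNilpotent (R := A)
  refine ⟨k, fun l hl h ↦ ?_⟩
  have hJ (x : A) (hx : x ∈ (⊥ : TwoSidedIdeal A).jacobson) : x ∈ Ring.jacobson A := by
    rw [← TwoSidedIdeal.mem_asIdeal, TwoSidedIdeal.asIdeal_jacobson] at hx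
    simpa [Ideal.jacobson_bot] using hx
  have := Ideal.list_prod_mem_pow _ l fun x hx ↦ hJ x (h x hx)
  rwa [hl, hk] at this

variable (K : Type u) [Field K] (F : Type u) [Field F] [Algebra K F] [Algebra K A]

variable (A) in
/-- Scalar extension commutes with taking the opposite algebra. -/
noncomputable def tensorOpRingEquiv : F ⊗[K] Aᵐᵒᵖ ≃+* (F ⊗[K] A)ᵐᵒᵖ :=
  ((Algebra.TensorProduct.congr (AlgEquiv.toOpposite K F) AlgEquiv.refl).trans
    (Algebra.TensorProduct.opAlgEquiv K K F A)).toRingEquiv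

/-- The quotient map of a `K`-algebra by a ring congruence, as a map of `K`-algebras. -/
def RingCon.mkAlgHom (c : RingCon A) : A →ₐ[K] c.Quotient :=
  { c.mk' with commutes' := fun _ ↦ rfl }

end JacobsonRadical

open TensorProduct in
/-- Let `A` be a finite-dimensional algebra over a field `K` with Jacobson
radical `J`, and let `F` be a field extension of `K`.  If the semisimple algebra `A/J` is
separable over `K` (i.e. `(A/J) ⊗_K L` is a semisimple ring for every field extension `L`
of `K`), then the global dimension of `A` (computed on right modules) equals the global
dimension of `A_F = A ⊗_K F`. -/
theorem globalDim_eq_globalDim_baseChange (K : Type u) [Field K] (A : Type u) [Ring A]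
    [Algebra K A] [FiniteDimensional K A] (F : Type u) [Field F] [Algebra K F]
    (hsep : ∀ (L : Type u) [Field L] [Algebra K L],
      IsSemisimpleRing (L ⊗[K] ((⊥ : TwoSidedIdeal A).jacobson.ringCon).Quotient)) :
    globalDim Aᵐᵒᵖ = globalDim (F ⊗[K] A)ᵐᵒᵖ := by
  let c := (⊥ : TwoSidedIdeal A).jacobson.ringCon
  let π : Aᵐᵒᵖ →ₐ[K] c.Quotientᵐᵒᵖ := (RingCon.mkAlgHom K c).op
  have hπ : Function.Surjective π := fun b ↦ by
    obtain ⟨a, ha⟩ := c.mk'_surjective b.unop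
    exact ⟨.op a, congrArg MulOpposite.op ha⟩
  have := hsep F
  have : IsSemisimpleRing (F ⊗[K] c.Quotientᵐᵒᵖ) :=
    (tensorOpRingEquiv c.Quotient K F).symm.isSemisimpleRing
  have : IsArtinianRing A := isArtinian_of_tower K inferInstance
  obtain ⟨k, hk⟩ := TwoSidedIdeal.exists_list_prod_eq_zero_of_jacobson (A := A)
  rw [← globalDim_eq_of_ringEquiv (tensorOpRingEquiv A K F)]
  refine (globalDim_le_globalDim_tensorProduct K F Aᵐᵒᵖ).antisymm
    (globalDim_tensorProduct_le_globalDim F π hπ (k := k) fun l hl h ↦ ?_)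
  refine MulOpposite.unop_injective ?_
  rw [MulOpposite.unop_list_prod]
  refine hk _ (by simpa using hl) fun x hx ↦ ?_
  have hx' : π (.op x) = 0 := h _ (by simpa using hx)
  exact (TwoSidedIdeal.mem_iff _ _).mpr (c.eq.mp (MulOpposite.op_injective hx'))
end

section
/- Let K be a field of characteristic two and let G be the quaternion group of order 8. Then for every integer n ≥ 1, the group algebra KG has no n-cluster tilting module. -/
open CategoryTheory

universe u

theorem ExtVanish.factor {R : Type u} [Ring R] {M N : ModuleCat.{u} R}
    (h : ExtVanish R 1 M N) (P : ProjectiveResolution M) (f : P.complex.X 1 ⟶ N)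
    (hf : P.complex.d 2 1 ≫ f = 0) : ∃ μ : P.complex.X 0 ⟶ N, P.complex.d 1 0 ≫ μ = f := by
  have hz : Limits.IsZero (((Ext ℤ (ModuleCat.{u} R) 1).obj (Opposite.op M)).obj N) :=
    @ModuleCat.isZero_of_subsingleton _ _ _ h
  have hz' := hz.of_iso (P.isoExt (R := ℤ) 1 N).symm
  rw [← HomologicalComplex.exactAt_iff_isZero_homology,
    HomologicalComplex.exactAt_iff' _ 0 1 2 (by simp) (by simp),
    ShortComplex.moduleCat_exact_iff] at hz'
  obtain ⟨μ, hμ⟩ := hz' f hf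
  exact ⟨μ, hμ⟩


theorem Module.Projective.exists_twisted {R P M : Type*} [Ring R] [AddCommGroup P] [Module R P]
    [Module.Projective R P] [AddCommGroup M] [Module R M] (ε : P →ₗ[R] M) (D : R →+ M →+ M)
    (hD : ∀ r s m, D (r * s) m = r • D s m + D r (s • m)) :
    ∃ l : P →+ M, ∀ (r : R) p, l (r • p) = r • l p + D r (ε p) := by
  obtain ⟨s, hs⟩ := Module.projective_def.1 (inferInstance : Module.Projective R P)
  let l : (P →₀ R) →+ M := Finsupp.liftAddHom fun p => D.flip (ε p)
  have hl (r : R) (x : P →₀ R) :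
      l (r • x) = r • l x + D r (ε (Finsupp.linearCombination R id x)) := by
    induction x using Finsupp.induction_linear with
    | zero => simp
    | add x y hx hy =>
      simp only [smul_add, map_add, hx, hy]
      abel
    | single p t =>
      rw [Finsupp.smul_single, smul_eq_mul, Finsupp.linearCombination_single, map_smul]
      simp only [l, Finsupp.liftAddHom_apply_single, AddMonoidHom.flip_apply, hD, id]
  refine ⟨l.comp s.toAddMonoidHom, fun r p => ?_⟩
  have := hl r (s p)
  rw [hs p] at this
  simpa using this

theorem ExtVanish.exists_primitive {R : Type u} [Ring R] {M : ModuleCat.{u} R}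
    (h : ExtVanish R 1 M M) (D : R →+ M →+ M)
    (hD : ∀ r s m, D (r * s) m = r • D s m + D r (s • m)) :
    ∃ φ : M →+ M, ∀ (r : R) m, φ (r • m) = r • φ m - D r m := by
  let P : ProjectiveResolution M := projectiveResolution M
  let ε : P.complex.X 0 ⟶ M := P.π.f 0
  have hε : Function.Surjective ε := (ModuleCat.epi_iff_surjective _).1 (inferInstanceAs (Epi (P.π.f 0)))
  have hdε : P.complex.d 1 0 ≫ ε = 0 := P.complex_d_comp_π_f_zero
  have hexact (x : P.complex.X 0) (hx : ε x = 0) : ∃ y, P.complex.d 1 0 y = x :=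
    (ShortComplex.moduleCat_exact_iff _).1 P.exact₀ x hx
  have : Module.Projective R (P.complex.X 0) :=
    (IsProjective.iff_projective _).2 (P.projective 0)
  obtain ⟨l, hl⟩ := Module.Projective.exists_twisted ε.hom D hD
  let f : P.complex.X 1 ⟶ M := ModuleCat.ofHom
    { toFun := fun x => l (P.complex.d 1 0 x)
      map_add' := fun x y => by simp
      map_smul' := fun r x => by
        have : ε (P.complex.d 1 0 x) = 0 := by
          rw [← ModuleCat.comp_apply, hdε]; rfl
        rw [map_smul, hl]
        change _ + D r (ε _) = _
        simp [this] }
  obtain ⟨μ, hμ⟩ := h.factor P f (by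
    ext x
    change l (P.complex.d 1 0 (P.complex.d 2 1 x)) = 0
    rw [← ModuleCat.comp_apply, P.complex.d_comp_d]
    exact map_zero l)
  let ψ : P.complex.X 0 →+ M := μ.hom.toAddMonoidHom - l
  have hψ (x) (hx : ε x = 0) : ψ x = 0 := by
    obtain ⟨y, rfl⟩ := hexact x hx
    have : μ (P.complex.d 1 0 y) = l (P.complex.d 1 0 y) := by
      rw [← ModuleCat.comp_apply, hμ]; rfl
    exact sub_eq_zero.2 this
  have hψε (x y) (hxy : ε x = ε y) : ψ x = ψ y := by
    rw [← sub_eq_zero, ← map_sub]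
    exact hψ _ (by rw [map_sub, hxy, sub_self])
  let s : M → P.complex.X 0 := Function.surjInv hε
  have hs (m) : ε (s m) = m := Function.surjInv_eq hε m
  refine ⟨AddMonoidHom.mk' (fun m => ψ (s m)) fun m n => ?_, fun r m => ?_⟩
  · rw [← map_add]
    exact hψε _ _ (by simp [hs])
  · have e : ψ (s (r • m)) = ψ (r • s m) := hψε _ _ (by simp [hs])
    have e' : ψ (r • s m) = r • ψ (s m) - D r (ε (s m)) := by
      change μ (r • s m) - l (r • s m) = r • (μ (s m) - l (s m)) - D r (ε (s m))
      rw [hl, map_smul, smul_sub, ← sub_sub]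
    rw [hs] at e'
    exact e.trans e'

open QuaternionGroup in
/-- The abelianization `Q₈ → 𝔽₂ × 𝔽₂`. -/
def quatAb : QuaternionGroup 2 → ZMod 2 × ZMod 2
  | a i => (0, (i.val : ZMod 2))
  | xa i => (1, (i.val : ZMod 2))

theorem quatAb_mul (g h : QuaternionGroup 2) : quatAb (g * h) = quatAb g + quatAb h := by
  revert g h; decide

open QuaternionGroup in
/-- The set-theoretic section of `quatAb` picks `1, i, j, ji`; this is the indicator function
of the complement of its image. -/
def quatSheet : QuaternionGroup 2 → ZMod 2
  | a i => if i.val < 2 then 0 else 1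
  | xa i => if i.val < 2 then 0 else 1

open QuaternionGroup in
/-- A set-theoretic section of `quatAb`. -/
def quatSection (v : ZMod 2 × ZMod 2) : QuaternionGroup 2 :=
  if v.1 = 0 then a (v.2.val : ZMod 4) else xa (v.2.val : ZMod 4)

/-- The cocycle of `Q₈` with values in functions on `𝔽₂ × 𝔽₂` which corresponds, by Shapiro's
lemma, to the nonzero homomorphism from the centre to `𝔽₂`. -/
def quatShapiro (g : QuaternionGroup 2) (v : ZMod 2 × ZMod 2) : ZMod 2 :=
  quatSheet (g⁻¹ * quatSection v) + quatSheet (quatSection v)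

theorem quatShapiro_mul (g h : QuaternionGroup 2) (v : ZMod 2 × ZMod 2) :
    quatShapiro (g * h) (v + quatAb g) = quatShapiro g (v + quatAb g) + quatShapiro h v := by
  revert g h v; decide

theorem quatShapiro_center (v : ZMod 2 × ZMod 2) :
    quatShapiro (QuaternionGroup.a 2) v = 1 := by
  revert v; decide

open QuaternionGroup in
theorem exists_trace_eq_one {C : Type*} [Ring C] [CharP C 2] (U : QuaternionGroup 2 →* C)
    (H : ∀ c : QuaternionGroup 2 → C, (∀ g h, c (g * h) = c g + U g * c h * U g⁻¹) →
      ∃ φ : C, ∀ g, U g * φ * U g⁻¹ = φ + c g) :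
    ∃ θ : C, ∑ g, U g * θ * U g⁻¹ = 1 := by
  let _ := ZMod.algebra C 2
  let k : ZMod 2 →+* C := algebraMap (ZMod 2) C
  have kc (s : ZMod 2) (x : C) : k s * x = x * k s := Algebra.commutes s x
  have inv (g) : U g * U g⁻¹ = 1 := by rw [← map_mul, mul_inv_cancel, map_one]
  have inv' (g) : U g⁻¹ * U g = 1 := by rw [← map_mul, inv_mul_cancel, map_one]
  have conj_mul (g) (x y : C) : U g * (x * y) * U g⁻¹ = (U g * x * U g⁻¹) * (U g * y * U g⁻¹) := by
    calc _ = U g * x * 1 * y * U g⁻¹ := by noncomm_ring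
      _ = _ := by rw [← inv' g]; noncomm_ring
  have conj_k (g) (s : ZMod 2) : U g * k s * U g⁻¹ = k s := by
    rw [← kc, mul_assoc, inv, mul_one]
  obtain ⟨φ, hφ⟩ := H (fun g => k (quatAb g).1) fun g h => by
    simp [conj_k, quatAb_mul]
  obtain ⟨ψ, hψ⟩ := H (fun g => k (quatAb g).2) fun g h => by
    simp [conj_k, quatAb_mul]
  let β (v : ZMod 2 × ZMod 2) : C := (φ + k v.1) * (ψ + k v.2)
  have conj_β (g v) : U g * β v * U g⁻¹ = β (v + quatAb g) := by
    simp only [β, conj_mul, mul_add, add_mul, conj_k, hφ, hψ, Prod.fst_add, Prod.snd_add, map_add]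
    abel
  have sum_β : ∑ v, β v = 1 := by
    have h2 : ∀ x : C, x + x = 0 := CharTwo.add_self_eq_zero
    have e : ∑ v, β v = φ * ψ + φ * (ψ + 1) + ((φ + 1) * ψ + (φ + 1) * (ψ + 1)) := by
      have : (Finset.univ : Finset (ZMod 2)) = {0, 1} := by decide
      simp [β, Fintype.sum_prod_type, this]
    have : φ * ψ + φ * (ψ + 1) + ((φ + 1) * ψ + (φ + 1) * (ψ + 1))
        = (φ * ψ + φ * ψ) + (φ * ψ + φ * ψ) + (φ + φ) + (ψ + ψ) + 1 := by noncomm_ring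
    rw [e, this]
    simp only [h2, zero_add]
  let c (g : QuaternionGroup 2) : C := ∑ v, β v * k (quatShapiro g v)
  have hc (g h) : c (g * h) = c g + U g * c h * U g⁻¹ := by
    have e1 : c (g * h) = ∑ v, β (v + quatAb g) * k (quatShapiro (g * h) (v + quatAb g)) :=
      (Fintype.sum_equiv (Equiv.addRight (quatAb g)) _ _ fun v => rfl).symm
    have e2 : c g = ∑ v, β (v + quatAb g) * k (quatShapiro g (v + quatAb g)) :=
      (Fintype.sum_equiv (Equiv.addRight (quatAb g)) _ _ fun v => rfl).symm
    rw [e1, e2, Finset.mul_sum, Finset.sum_mul, ← Finset.sum_add_distrib]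
    refine Finset.sum_congr rfl fun v _ => ?_
    rw [conj_mul, conj_k, conj_β, quatShapiro_mul, map_add, mul_add]
  obtain ⟨χ, hχ⟩ := H c hc
  refine ⟨β 0 * χ, ?_⟩
  have hz : c (a 2) = 1 := by simp [c, quatShapiro_center, sum_β]
  have hcz (g) : c (g * a 2) = c g + 1 := by rw [hc, hz, mul_one, inv]
  simp only [conj_mul, hχ, conj_β, zero_add]
  have pair (g) : β (quatAb g) * (χ + c g) + β (quatAb (g * a 2)) * (χ + c (g * a 2))
      = β (quatAb g) := by
    have : quatAb (a 2) = 0 := by decide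
    rw [quatAb_mul, this, add_zero, hcz, ← mul_add, ← add_assoc χ (c g) 1,
      ← add_assoc (χ + c g), CharTwo.add_self_eq_zero, zero_add, mul_one]
  let e : (ZMod 2 × ZMod 2) × Bool ≃ QuaternionGroup 2 :=
    Equiv.ofBijective (fun p => if p.2 then quatSection p.1 * a 2 else quatSection p.1) (by decide)
  have quatAb_section (v) : quatAb (quatSection v) = v := by revert v; decide
  rw [← e.sum_comp, Fintype.sum_prod_type, ← sum_β]
  refine Finset.sum_congr rfl fun v _ => ?_
  rw [Fintype.sum_bool, add_comm]
  exact (pair (quatSection v)).trans (by rw [quatAb_section])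

open MulOpposite MonoidAlgebra

section GroupAlgebra

variable {K G M N P : Type*} [Field K] [Group G]
  [AddCommGroup M] [Module K M] [Module (MonoidAlgebra K G)ᵐᵒᵖ M]
  [IsScalarTower K (MonoidAlgebra K G)ᵐᵒᵖ M]
  [AddCommGroup N] [Module K N] [Module (MonoidAlgebra K G)ᵐᵒᵖ N]
  [IsScalarTower K (MonoidAlgebra K G)ᵐᵒᵖ N]

theorem op_single_eq_smul (g : G) (k : K) :
    op (single g k) = k • op (single g (1 : K)) := by
  rw [← op_smul, smul_single, smul_eq_mul, mul_one]

theorem map_smul_of_map_single_smul (f : M →ₗ[K] N)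
    (hf : ∀ (g : G) m, f (op (single g (1 : K)) • m) = op (single g (1 : K)) • f m)
    (r : (MonoidAlgebra K G)ᵐᵒᵖ) (m : M) : f (r • m) = r • f m := by
  induction r using MulOpposite.rec' with | _ r =>
  induction r using MonoidAlgebra.induction_linear with
  | zero => simp
  | add x y hx hy => simp only [MulOpposite.op_add, add_smul, map_add, hx, hy]
  | single g k => rw [op_single_eq_smul, smul_assoc, smul_assoc, map_smul, hf]

variable (K G M) in
/-- The left representation of `G` on a right module over the group algebra. -/
noncomputable def opRep : G →* Module.End K M where
  toFun g := Algebra.lsmul K K M (op (single g⁻¹ (1 : K)))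
  map_one' := by
    rw [inv_one, ← MonoidAlgebra.one_def, op_one, map_one]
  map_mul' g h := by
    rw [← map_mul, ← op_mul, single_mul_single, mul_inv_rev, mul_one]

theorem opRep_apply (g : G) (m : M) : opRep K G M g m = op (single g⁻¹ (1 : K)) • m := rfl

theorem single_smul_eq (g : G) (m : M) : op (single g (1 : K)) • m = opRep K G M g⁻¹ m := by
  rw [opRep_apply, inv_inv]

/-- The derivation of the group algebra attached to a map `c : G → End_K M`. -/
noncomputable def opDer (c : G → Module.End K M) :
    (MonoidAlgebra K G)ᵐᵒᵖ →ₗ[K] Module.End K M :=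
  Finsupp.linearCombination K (fun g => c g⁻¹ * opRep K G M g⁻¹) ∘ₗ
    (coeffLinearEquiv K).toLinearMap ∘ₗ (opLinearEquiv K).symm.toLinearMap

theorem opDer_single (c : G → Module.End K M) (g : G) (k : K) :
    opDer c (op (single g k)) = k • (c g⁻¹ * opRep K G M g⁻¹) := by
  simp [opDer]

theorem opDer_mul (c : G → Module.End K M)
    (hc : ∀ g h, c (g * h) = c g + opRep K G M g * c h * opRep K G M g⁻¹)
    (r s : (MonoidAlgebra K G)ᵐᵒᵖ) (m : M) :
    opDer c (r * s) m = r • opDer c s m + opDer c r (s • m) := by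
  induction r using MulOpposite.rec' with | _ r =>
  induction s using MulOpposite.rec' with | _ s =>
  induction r using MonoidAlgebra.induction_linear with
  | zero => simp
  | add x y hx hy =>
    simp only [MulOpposite.op_add, add_mul, add_smul, map_add, hx, hy, LinearMap.add_apply]
    abel
  | single g k =>
    induction s using MonoidAlgebra.induction_linear with
    | zero => simp
    | add x y hx hy =>
      simp only [MulOpposite.op_add, mul_add, add_smul, smul_add, map_add, hx, hy, LinearMap.add_apply]
      abel
    | single h l =>
      have inv (x : M) : opRep K G M g (opRep K G M g⁻¹ x) = x := by
        rw [← Module.End.mul_apply, ← map_mul, mul_inv_cancel, map_one, Module.End.one_apply]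
      rw [← op_mul, single_mul_single, opDer_single, opDer_single, opDer_single,
        op_single_eq_smul, op_single_eq_smul h l, smul_assoc, smul_assoc, single_smul_eq,
        single_smul_eq, mul_inv_rev, hc, map_mul, inv_inv]
      simp only [LinearMap.smul_apply, Module.End.mul_apply, LinearMap.add_apply, map_smul,
        smul_add, smul_smul, inv]
      rw [mul_comm l k, add_comm]

end GroupAlgebra

theorem ExtVanish.exists_conj_eq_add {K : Type u} {G : Type} [Field K] [Group G]
    {M : ModuleCat.{u} (MonoidAlgebra K G)ᵐᵒᵖ} [Module K M]
    [IsScalarTower K (MonoidAlgebra K G)ᵐᵒᵖ M]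
    (h : ExtVanish (MonoidAlgebra K G)ᵐᵒᵖ 1 M M) (c : G → Module.End K M)
    (hc : ∀ g h, c (g * h) = c g + opRep K G M g * c h * opRep K G M g⁻¹) :
    ∃ φ : Module.End K M, ∀ g, opRep K G M g * φ * opRep K G M g⁻¹ = φ + c g := by
  let D : (MonoidAlgebra K G)ᵐᵒᵖ →+ M →+ M :=
    AddMonoidHom.mk' (fun r => (opDer c r).toAddMonoidHom) fun r s => by
      ext m; simp
  obtain ⟨φ, hφ⟩ := h.exists_primitive D (opDer_mul c hc)
  have hφ' (r : (MonoidAlgebra K G)ᵐᵒᵖ) (m : M) : φ (r • m) = r • φ m - opDer c r m := hφ r m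
  have hc1 : c 1 = 0 := by simpa using hc 1 1
  refine ⟨{ φ with map_smul' := fun k m => ?_ }, fun g => ?_⟩
  · have := hφ' (op (single 1 k)) m
    rw [opDer_single, op_single_eq_smul, smul_assoc, smul_assoc, ← MonoidAlgebra.one_def] at this
    simpa [hc1] using this
  · ext m
    have := hφ' (op (single g⁻¹ 1)) (opRep K G M g⁻¹ m)
    rw [opDer_single, ← opRep_apply, ← opRep_apply, ← Module.End.mul_apply, ← map_mul] at this
    simp only [inv_inv, one_smul, Module.End.mul_apply] at this
    rw [← Module.End.mul_apply (opRep K G M g), ← map_mul] at this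
    simp only [mul_inv_cancel, map_one, Module.End.one_apply] at this
    change opRep K G M g (φ (opRep K G M g⁻¹ m)) = φ m + c g m
    rw [this, sub_add_cancel]

theorem Module.Projective.of_trace_eq_one {K G M : Type*} [Field K] [Group G] [Fintype G]
    [AddCommGroup M] [Module K M] [Module (MonoidAlgebra K G)ᵐᵒᵖ M]
    [IsScalarTower K (MonoidAlgebra K G)ᵐᵒᵖ M] (θ : Module.End K M)
    (hθ : ∑ g, opRep K G M g * θ * opRep K G M g⁻¹ = 1) :
    Module.Projective (MonoidAlgebra K G)ᵐᵒᵖ M := by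
  let π : (M →₀ (MonoidAlgebra K G)ᵐᵒᵖ) →ₗ[(MonoidAlgebra K G)ᵐᵒᵖ] M :=
    Finsupp.linearCombination _ id
  have hπ : Function.Surjective π := Finsupp.linearCombination_id_surjective _ M
  obtain ⟨s, hs⟩ := (π.restrictScalars K).exists_rightInverse_of_surjective
    (LinearMap.range_eq_top.2 hπ)
  let t : M →ₗ[K] (M →₀ (MonoidAlgebra K G)ᵐᵒᵖ) :=
    ∑ g, opRep K G _ g ∘ₗ s ∘ₗ θ ∘ₗ opRep K G M g⁻¹
  have ht_apply (m : M) : t m = ∑ g, opRep K G _ g (s (θ (opRep K G M g⁻¹ m))) := by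
    simp [t]
  have ht (g : G) (m : M) : t (opRep K G M g m) = opRep K G _ g (t m) := by
    rw [ht_apply, ht_apply, map_sum]
    refine (Fintype.sum_equiv (Equiv.mulLeft g) _ _ fun h => ?_).symm
    rw [Equiv.coe_mulLeft, mul_inv_rev, ← Module.End.mul_apply _ (opRep K G M g),
      ← map_mul (opRep K G M), inv_mul_cancel_right, map_mul,
      Module.End.mul_apply]
  let t' : M →ₗ[(MonoidAlgebra K G)ᵐᵒᵖ] (M →₀ (MonoidAlgebra K G)ᵐᵒᵖ) :=
    { t with
      map_smul' := map_smul_of_map_single_smul t fun g m => by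
        rw [single_smul_eq, single_smul_eq, ht] }
  refine Module.Projective.of_split t' π (LinearMap.ext fun m => ?_)
  change π (t m) = m
  have hs' (m) : π (s m) = m := LinearMap.congr_fun hs m
  rw [ht_apply, map_sum]
  simp only [opRep_apply, map_smul, hs']
  exact LinearMap.congr_fun hθ m |> fun h => by simpa [opRep_apply] using h

theorem ExtVanish.projective {K : Type u} [Field K] [CharP K 2]
    {M : ModuleCat.{u} (MonoidAlgebra K (QuaternionGroup 2))ᵐᵒᵖ} [Module K M]
    [IsScalarTower K (MonoidAlgebra K (QuaternionGroup 2))ᵐᵒᵖ M]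
    (h : ExtVanish (MonoidAlgebra K (QuaternionGroup 2))ᵐᵒᵖ 1 M M) :
    Module.Projective (MonoidAlgebra K (QuaternionGroup 2))ᵐᵒᵖ M := by
  rcases subsingleton_or_nontrivial M with hM | hM
  · infer_instance
  · have : CharP (Module.End K M) 2 :=
      charP_of_injective_algebraMap (algebraMap K (Module.End K M)).injective 2
    obtain ⟨θ, hθ⟩ := exists_trace_eq_one (opRep K _ M) h.exists_conj_eq_add
    exact .of_trace_eq_one θ hθ

/-- The ascending chain of subspaces defined by `W₀ = 0` and `Wₘ₊₁ = u⁻¹ (v Wₘ)`. -/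
def kroneckerChain {K V : Type*} [Field K] [AddCommGroup V] [Module K V]
    (u v : Module.End K V) : ℕ → Submodule K V
  | 0 => ⊥
  | m + 1 => ((kroneckerChain u v m).map v).comap u

theorem kroneckerChain_mono {K V : Type*} [Field K] [AddCommGroup V] [Module K V]
    (u v : Module.End K V) : Monotone (kroneckerChain u v) := by
  refine monotone_nat_of_le_succ fun m => ?_
  induction m with
  | zero => exact bot_le
  | succ m ih => exact Submodule.comap_mono (Submodule.map_mono ih)

theorem kroneckerChain_map {K V W : Type*} [Field K] [AddCommGroup V] [Module K V]
    [AddCommGroup W] [Module K W] {u v : Module.End K V} {u' v' : Module.End K W}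
    (f : V →ₗ[K] W) (hu : ∀ x, f (u x) = u' (f x)) (hv : ∀ x, f (v x) = v' (f x)) (m : ℕ) :
    ∀ x ∈ kroneckerChain u v m, f x ∈ kroneckerChain u' v' m := by
  induction m with
  | zero =>
    intro x hx
    rw [(Submodule.mem_bot K).1 hx, map_zero]
    exact zero_mem _
  | succ m ih =>
    rintro x ⟨y, hy, hxy⟩
    exact ⟨f y, ih y hy, by rw [← hv, hxy, hu]⟩

/-- `kroneckerChain` stabilises no later on a member of `add M` than on `M`. -/
theorem MemAdd.kroneckerChain_le {K R : Type u} [Field K] [Ring R] [Algebra K R]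
    {M X : ModuleCat.{u} R} [Module K M] [IsScalarTower K R M] [Module K X] [IsScalarTower K R X]
    (h : MemAdd R M X) (u v : R) {a b : ℕ}
    (hM : kroneckerChain (Algebra.lsmul K K M u) (Algebra.lsmul K K M v) a ≤
      kroneckerChain (Algebra.lsmul K K M u) (Algebra.lsmul K K M v) b) :
    kroneckerChain (Algebra.lsmul K K X u) (Algebra.lsmul K K X v) a ≤
      kroneckerChain (Algebra.lsmul K K X u) (Algebra.lsmul K K X v) b := by
  obtain ⟨k, f, g, hgf⟩ := h
  intro x hx
  have hx' : x = ∑ j, g (LinearMap.single R (fun _ => M) j (f x j)) := by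
    rw [← map_sum]
    have := LinearMap.congr_fun hgf x
    simp only [LinearMap.comp_apply, LinearMap.id_apply] at this
    nth_rw 1 [← this]
    congr 1
    exact (Finset.univ_sum_single (f x)).symm
  rw [hx']
  refine Submodule.sum_mem _ fun j _ => ?_
  have h1 := kroneckerChain_map (u' := Algebra.lsmul K K M u) (v' := Algebra.lsmul K K M v)
    ((LinearMap.proj j ∘ₗ f).restrictScalars K)
    (fun y => by simp) (fun y => by simp) a x hx
  exact kroneckerChain_map (u := Algebra.lsmul K K M u) (v := Algebra.lsmul K K M v)
    (u' := Algebra.lsmul K K X u) (v' := Algebra.lsmul K K X v)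
    ((g ∘ₗ LinearMap.single R (fun _ => M) j).restrictScalars K)
    (fun y => (g ∘ₗ LinearMap.single R (fun _ => M) j).map_smul u y)
    (fun y => (g ∘ₗ LinearMap.single R (fun _ => M) j).map_smul v y) b _ (hM h1)

section KroneckerModule

variable {K P : Type*} [Field K] [CommRing P] [Algebra K P] {t : P}
  {u v : Module.End K (TrivSqZeroExt P P)}

open TrivSqZeroExt

theorem pow_mul_fst_eq_zero_of_mem_kroneckerChain (hu : ∀ b, u b = inr t * b)
    (hv : ∀ b, v b = inr 1 * b) (m : ℕ) :
    ∀ b ∈ kroneckerChain u v m, t ^ m * b.fst = 0 := by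
  induction m with
  | zero =>
    intro b hb
    rw [(Submodule.mem_bot K).1 hb, fst_zero, mul_zero]
  | succ m ih =>
    rintro b ⟨y, hy, hyb⟩
    have : y.fst = t * b.fst := by simpa [hu, hv, mul_comm] using congrArg snd hyb
    rw [pow_succ, mul_assoc, ← this, ih y hy]

theorem inl_mem_kroneckerChain (hu : ∀ b, u b = inr t * b)
    (hv : ∀ b, v b = inr 1 * b) (m : ℕ) :
    ∀ p : P, t ^ m * p = 0 → inl p ∈ kroneckerChain u v m := by
  induction m with
  | zero =>
    intro p hp
    rw [pow_zero, one_mul] at hp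
    rw [hp, inl_zero]
    exact zero_mem _
  | succ m ih =>
    intro p hp
    refine ⟨inl (t * p), ih _ (by rw [← mul_assoc, ← pow_succ, hp]), ?_⟩
    rw [hu, hv]
    ext <;> simp

variable (K t) [CharP K 2]

/-- The homomorphism from `Q₈` to the units of `P[ε]` with `i ↦ 1 + t ε` and `j ↦ 1 + ε`. -/
noncomputable def quatToDual : QuaternionGroup 2 →* TrivSqZeroExt P P where
  toFun g := 1 + inr (algebraMap K P (ZMod.castHom dvd_rfl K (quatAb g).2) * t +
    algebraMap K P (ZMod.castHom dvd_rfl K (quatAb g).1))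
  map_one' := by
    have : quatAb 1 = 0 := by decide
    simp [this]
  map_mul' g h := by
    rw [quatAb_mul, Prod.fst_add, Prod.snd_add]
    ext
    · simp
    · simp
      ring

/-- The action of the (opposite) group algebra of `Q₈` on `P[ε]`. -/
noncomputable def algebraToDual :
    (MonoidAlgebra K (QuaternionGroup 2))ᵐᵒᵖ →ₐ[K] TrivSqZeroExt P P :=
  (MonoidAlgebra.lift K _ _ (quatToDual K t)).fromOpposite fun _ _ => Commute.all _ _

theorem algebraToDual_single (g : QuaternionGroup 2) :
    algebraToDual K t (op (single g 1)) = quatToDual K t g := by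
  simp [algebraToDual]

theorem algebraToDual_i_sub_one :
    algebraToDual K t (op (single (QuaternionGroup.a 1) 1) - 1) = inr t := by
  have : quatAb (QuaternionGroup.a 1) = (0, 1) := by decide
  rw [map_sub, map_one, algebraToDual_single]
  simp [quatToDual, this]

theorem algebraToDual_j_sub_one :
    algebraToDual K t (op (single (QuaternionGroup.xa 0) 1) - 1) = inr 1 := by
  have : quatAb (QuaternionGroup.xa 0) = (1, 0) := by decide
  rw [map_sub, map_one, algebraToDual_single]
  simp [quatToDual, this]

end KroneckerModule

/-- The group algebra of `Q₈` in characteristic two has infinite representation type. -/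
theorem exists_finite_not_memAdd (K : Type u) [Field K] [CharP K 2]
    (M : ModuleCat.{u} (MonoidAlgebra K (QuaternionGroup 2))ᵐᵒᵖ)
    [Module.Finite (MonoidAlgebra K (QuaternionGroup 2))ᵐᵒᵖ M]
    [Module K M] [IsScalarTower K (MonoidAlgebra K (QuaternionGroup 2))ᵐᵒᵖ M] :
    ∃ X : ModuleCat.{u} (MonoidAlgebra K (QuaternionGroup 2))ᵐᵒᵖ,
      Module.Finite (MonoidAlgebra K (QuaternionGroup 2))ᵐᵒᵖ X ∧
        ¬ MemAdd (MonoidAlgebra K (QuaternionGroup 2))ᵐᵒᵖ M X := by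
  let R := (MonoidAlgebra K (QuaternionGroup 2))ᵐᵒᵖ
  have : Module.Finite K R :=
    Module.Finite.equiv (opLinearEquiv K (M := MonoidAlgebra K (QuaternionGroup 2)))
  have : Module.Finite K M := Module.Finite.trans R M
  let u : R := op (single (QuaternionGroup.a 1) 1) - 1
  let v : R := op (single (QuaternionGroup.xa 0) 1) - 1
  obtain ⟨N, hN⟩ := monotone_stabilizes_iff_noetherian.2 (inferInstanceAs (IsNoetherian K M))
    ⟨_, kroneckerChain_mono (Algebra.lsmul K K M u) (Algebra.lsmul K K M v)⟩
  let p : Polynomial K := Polynomial.X ^ (N + 1)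
  have hp : p.Monic := Polynomial.monic_X_pow _
  let P := AdjoinRoot p
  have : Module.Finite K P := hp.finite_adjoinRoot
  let t : P := AdjoinRoot.root p
  let B := TrivSqZeroExt P P
  have : Module.Finite K B := inferInstanceAs (Module.Finite K (P × P))
  let _ : Module R B := Module.compHom B (algebraToDual K t).toRingHom
  have smul_def (r : R) (b : B) : r • b = algebraToDual K t r * b := rfl
  have : IsScalarTower K R B := ⟨fun k r b => by
    rw [smul_def, smul_def, map_smul, smul_mul_assoc]⟩
  refine ⟨ModuleCat.of R B, Module.Finite.of_restrictScalars_finite K R B, fun h => ?_⟩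
  let _ : Module K (ModuleCat.of R B) := inferInstanceAs (Module K B)
  have : IsScalarTower K R (ModuleCat.of R B) := inferInstanceAs (IsScalarTower K R B)
  have hle := h.kroneckerChain_le (K := K) u v (hN (N + 1) N.le_succ).ge
  have hu (b : B) : Algebra.lsmul K K B u b = TrivSqZeroExt.inr t * b := by
    rw [← algebraToDual_i_sub_one K t]; rfl
  have hv (b : B) : Algebra.lsmul K K B v b = TrivSqZeroExt.inr 1 * b := by
    rw [← algebraToDual_j_sub_one K t]; rfl
  have ht (m : ℕ) : t ^ m = AdjoinRoot.mk p (Polynomial.X ^ m) := by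
    rw [map_pow, AdjoinRoot.mk_X]
  have hmem := inl_mem_kroneckerChain hu hv (N + 1) 1 (by
    rw [ht, mul_one, AdjoinRoot.mk_self])
  have h0 := pow_mul_fst_eq_zero_of_mem_kroneckerChain hu hv N _ (hle hmem)
  rw [TrivSqZeroExt.fst_inl, mul_one, ht, AdjoinRoot.mk_eq_zero,
    Polynomial.X_pow_dvd_iff] at h0
  simpa using h0 N N.lt_succ_self

/-- Let `K` be a field of characteristic two and let `G` be the quaternion
group of order `8`.  Then for every integer `n ≥ 1`, the group algebra `KG` has no
`n`-cluster tilting (right) module. -/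
theorem monoidAlgebra_quaternionGroup_no_nClusterTilting (K : Type u) [Field K] [CharP K 2]
    (n : ℕ) (hn : 1 ≤ n) :
    ¬ ∃ M : ModuleCat.{u} (MonoidAlgebra K (QuaternionGroup 2))ᵐᵒᵖ,
        IsNClusterTilting (MonoidAlgebra K (QuaternionGroup 2))ᵐᵒᵖ n M := by
  rintro ⟨M, hfin, hM, -⟩
  let _ : Module K M := Module.compHom M
    (algebraMap K (MonoidAlgebra K (QuaternionGroup 2))ᵐᵒᵖ)
  have : IsScalarTower K (MonoidAlgebra K (QuaternionGroup 2))ᵐᵒᵖ M := ⟨fun k r m => by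
    rw [Algebra.smul_def, mul_smul]; rfl⟩
  obtain ⟨X, hX, hMX⟩ := exists_finite_not_memAdd K M
  refine hMX ((hM X hX).2 fun i hi hin => ?_)
  have hMM : MemAdd (MonoidAlgebra K (QuaternionGroup 2))ᵐᵒᵖ M M :=
    ⟨1, LinearMap.pi fun _ => LinearMap.id, LinearMap.proj 0, rfl⟩
  have hproj := ((hM M hfin).1 hMM 1 le_rfl (hi.trans hin)).projective
  have : Projective M := (IsProjective.iff_projective M).1 hproj
  obtain ⟨i, rfl⟩ := Nat.exists_eq_add_of_le' hi
  exact ModuleCat.subsingleton_of_isZero (isZero_Ext_succ_of_projective M X i)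
end
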